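/- arXiv:1802.09449 — 3 statements merged into one kernel-verified Lean document; each statement's English description precedes it below -/
import Mathlib

section
/- Let p be a prime with p ≡ ±3 or ±13 (mod 40) (so that G = PSL₂(p) contains A₄ as a maximal subgroup) and suppose 3 divides p + 1. Then there exists a maximal coclique A of G with |A| ≥ (3/2)(p + 1) + 3 (i.e. 2·|A| ≥ 3(p + 1) + 6) such that A is not the underlying set of any maximal subgroup of G and A is not the set of all involutions of G. -/
open scoped MatrixGroups

/-- A subset `A` of a group `G` is a *coclique* if any two of its elements
generate a proper subgroup of `G`. -/
def IsCoclique {G : Type*} [Group G] (A : Set G) : Prop :=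
  ∀ g ∈ A, ∀ h ∈ A, Subgroup.closure {g, h} ≠ ⊤

/-- A coclique is *maximal* if the only coclique containing it is itself. -/
def IsMaximalCoclique {G : Type*} [Group G] (A : Set G) : Prop :=
  IsCoclique A ∧ ∀ B : Set G, IsCoclique B → A ⊆ B → A = B

section SmallInvariantSet

variable {G : Type*} [Group G]

/-- If a set of at most three elements is invariant under conjugation by `u`, then `u ^ 6`
centralizes it. -/
lemma pow_six_mul_comm_of_mem_normalizer {S : Set G} (hfin : S.Finite) (hS : S.ncard ≤ 3) {u g : G}
    (hu : u ∈ Subgroup.normalizer S) (hg : g ∈ S) : u ^ 6 * g = g * u ^ 6 := by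
  classical
  have := hfin.fintype
  let e : Equiv.Perm S := (MulAut.conj u).toEquiv.subtypeEquiv fun n => hu n
  have he : ∀ (n : ℕ) (s : S), ((e ^ n) s : G) = u ^ n * s * (u ^ n)⁻¹ := by
    intro n
    induction n with
    | zero => simp
    | succ n ih =>
      intro s
      rw [pow_succ', Equiv.Perm.mul_apply]
      have : ((e ((e ^ n) s) : S) : G) = u * ((e ^ n) s : G) * u⁻¹ := rfl
      rw [this, ih, pow_succ']
      group
  have hcard : Fintype.card (Equiv.Perm S) ∣ 6 := by
    rw [Fintype.card_perm, ← Set.toFinset_card, ← Set.ncard_eq_toFinset_card']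
    exact Nat.factorial_dvd_factorial hS
  obtain ⟨k, hk⟩ := hcard
  have h6 : e ^ 6 = 1 := by rw [hk, pow_mul, pow_card_eq_one, one_pow]
  have := he 6 ⟨g, hg⟩
  rw [h6] at this
  exact mul_inv_eq_iff_eq_mul.mp this.symm

lemma normalizer_eq_top_of_closure_pair {a b : G} (hab : Subgroup.closure {a, b} = ⊤) {S : Set G}
    (hfin : S.Finite) (ha : ∀ s ∈ S, a * s * a⁻¹ ∈ S) (hb : ∀ s ∈ S, b * s * b⁻¹ ∈ S) :
    Subgroup.normalizer S = ⊤ := by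
  have := hfin.to_subtype
  rw [eq_top_iff, ← hab, Subgroup.closure_le]
  rintro g (rfl | rfl)
  exacts [Subgroup.mem_normalizer_fintype ha, Subgroup.mem_normalizer_fintype hb]

/-- The only element of `G` lying in a conjugation-invariant set of at most three elements
is the identity. -/
def NoSmallClass (G : Type*) [Group G] : Prop :=
  ∀ S : Set G, S.Finite → S.ncard ≤ 3 → Subgroup.normalizer S = ⊤ → ∀ g ∈ S, g = 1

lemma NoSmallClass.eq_one_of_closure_pair (hG : NoSmallClass G) {a b : G}
    (hab : Subgroup.closure {a, b} = ⊤) (g g' g'' : G)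
    (ha : ∀ s ∈ ({g, g', g''} : Set G), a * s * a⁻¹ ∈ ({g, g', g''} : Set G))
    (hb : ∀ s ∈ ({g, g', g''} : Set G), b * s * b⁻¹ ∈ ({g, g', g''} : Set G)) : g = 1 := by
  have hfin : ({g, g', g''} : Set G).Finite := by simp
  refine hG _ hfin ?_ (normalizer_eq_top_of_closure_pair hab hfin ha hb) g (by simp)
  calc _ ≤ ({g', g''} : Set G).ncard + 1 := Set.ncard_insert_le _ _
    _ ≤ _ := by have := Set.ncard_insert_le g' {g''}; simp at this; omega

lemma NoSmallClass.closure_ne_top_of_commute [Nontrivial G] (hG : NoSmallClass G) {a b : G}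
    (hab : a * b = b * a) : Subgroup.closure {a, b} ≠ ⊤ := by
  intro h
  have ha : a = 1 := hG.eq_one_of_closure_pair h a a a (by simp) (by simp [← hab])
  have hb : b = 1 := hG.eq_one_of_closure_pair h b b b (by simp [hab]) (by simp)
  simp only [ha, hb, Set.pair_eq_singleton, Subgroup.closure_singleton_one] at h
  exact bot_ne_top h

lemma NoSmallClass.closure_ne_top_of_involutions [Nontrivial G] (hG : NoSmallClass G) {a b : G}
    (ha : a * a = 1) (hb : b * b = 1) : Subgroup.closure {a, b} ≠ ⊤ := by
  intro h
  have ha' : a⁻¹ = a := inv_eq_of_mul_eq_one_left ha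
  have hb' : b⁻¹ = b := inv_eq_of_mul_eq_one_left hb
  have key : a * b = 1 := by
    refine hG.eq_one_of_closure_pair h (a * b) (b * a) (b * a) ?_ ?_
    · simp [ha', ha, ← mul_assoc]
      simp [mul_assoc, ha]
    · simp [hb', hb, ← mul_assoc]
      simp [mul_assoc, hb]
  refine hG.closure_ne_top_of_commute ?_ h
  simpa [ha', hb', key] using (mul_inv_rev a b)

lemma NoSmallClass.closure_ne_top_of_inverts [Nontrivial G] (hG : NoSmallClass G) {x t : G}
    (ht : t * t = 1) (hxt : (x * t) * (x * t) = 1) : Subgroup.closure {x, t} ≠ ⊤ := by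
  intro h
  have ht' : t⁻¹ = t := inv_eq_of_mul_eq_one_left ht
  have h1 : t * x * t = x⁻¹ := by
    rw [eq_inv_iff_mul_eq_one, ← mul_right_inj x, ← mul_left_inj x⁻¹]
    simpa [mul_assoc] using hxt
  have h2 : t * x⁻¹ * t = x := by
    rw [← h1]; simp only [← mul_assoc, ht, one_mul]; rw [mul_assoc, ht, mul_one]
  have hx : x = 1 := by
    refine hG.eq_one_of_closure_pair h x x⁻¹ x⁻¹ (by simp) ?_
    simp [ht', h1, h2]
  exact hG.closure_ne_top_of_commute (by simp [hx]) h

lemma NoSmallClass.closure_ne_top_of_tetrahedral [Nontrivial G] (hG : NoSmallClass G) {x t : G}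
    (hx : x * x * x = 1) (ht : t * t = 1) (hxt : (x * t) * (x * t) * (x * t) = 1) :
    Subgroup.closure {x, t} ≠ ⊤ := by
  intro h
  have ht' : t⁻¹ = t := inv_eq_of_mul_eq_one_left ht
  have hx2 : x⁻¹ = x * x := inv_eq_of_mul_eq_one_left hx
  have hx2' : ∀ z, x * (x * z) = x⁻¹ * z := fun z => by rw [hx2, mul_assoc]
  have hx3 : x⁻¹ * x⁻¹ = x := by rw [← mul_inv_rev, ← hx2, inv_inv]
  have hx3' : ∀ z, x⁻¹ * (x⁻¹ * z) = x * z := fun z => by rw [← mul_assoc, hx3]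
  have htt : ∀ z, t * (t * z) = z := fun z => by rw [← mul_assoc, ht, one_mul]
  have htx : t * (x * t) = x⁻¹ * (t * x⁻¹) := by
    rw [← mul_right_inj x, ← mul_left_inj (x * t)]
    simp only [mul_assoc] at hxt ⊢
    simp [hxt, ht]
  have htx' : ∀ z, t * (x * (t * z)) = x⁻¹ * (t * (x⁻¹ * z)) := fun z => by
    simpa [mul_assoc] using congrArg (· * z) htx
  have hty : t * (x⁻¹ * t) = x * (t * x) := by
    simpa [ht', mul_assoc] using congrArg (·⁻¹) htx
  have hty' : ∀ z, t * (x⁻¹ * (t * z)) = x * (t * (x * z)) := fun z => by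
    simpa [mul_assoc] using congrArg (· * z) hty
  have key : t = 1 := by
    refine hG.eq_one_of_closure_pair h t (x * t * x⁻¹) (x⁻¹ * t * x) ?_ ?_
    · simp [mul_assoc, hx2', hx3]
    · simp [mul_assoc, ht', ht, htx', hty', htx, hty, hx2', hx3', ← hx2, hx3]
  exact hG.closure_ne_top_of_commute (by simp [key]) h

/-- The elements `1`, `x` and `x⁻¹`, together with the elements `t` of order dividing `2`
for which `x * t` has order dividing `2` or `3`. -/
def smallProductSet (x : G) : Set G :=
  {1, x, x⁻¹} ∪ {t | t * t = 1 ∧ ((x * t) * (x * t) = 1 ∨ (x * t) * (x * t) * (x * t) = 1)}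

lemma closure_inv_pair (x t : G) : Subgroup.closure {x⁻¹, t} = Subgroup.closure {x, t} := by
  apply le_antisymm <;> rw [Subgroup.closure_le] <;> rintro g (rfl | rfl)
  · exact Subgroup.inv_mem _ (Subgroup.subset_closure (by simp))
  · exact Subgroup.subset_closure (by simp)
  · exact (Subgroup.inv_mem_iff _).mp (Subgroup.subset_closure (by simp))
  · exact Subgroup.subset_closure (by simp)

lemma NoSmallClass.isCoclique_smallProductSet [Nontrivial G] (hG : NoSmallClass G) {x : G}
    (hx : x * x * x = 1) : IsCoclique (smallProductSet x) := by
  have mixed : ∀ g ∈ ({1, x, x⁻¹} : Set G), ∀ t,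
      t * t = 1 ∧ ((x * t) * (x * t) = 1 ∨ (x * t) * (x * t) * (x * t) = 1) →
        Subgroup.closure {g, t} ≠ ⊤ := by
    intro g hg t ht
    have key : Subgroup.closure {x, t} ≠ ⊤ := by
      rcases ht with ⟨ht, h | h⟩
      exacts [hG.closure_ne_top_of_inverts ht h, hG.closure_ne_top_of_tetrahedral hx ht h]
    rcases hg with rfl | rfl | rfl
    · exact hG.closure_ne_top_of_commute (by simp)
    · exact key
    · rwa [closure_inv_pair]
  rintro g (hg | hg) h (hh | hh)
  · apply hG.closure_ne_top_of_commute
    rcases hg with rfl | rfl | rfl <;> rcases hh with rfl | rfl | rfl <;> simp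
  · exact mixed g hg h hh
  · rw [Set.pair_comm]
    exact mixed h hh g hg
  · exact hG.closure_ne_top_of_involutions hg.1 hh.1

end SmallInvariantSet

open Matrix Matrix.SpecialLinearGroup
open scoped MatrixGroups

section SL2

variable {F : Type*} [Field F]

lemma PSL2.mk_eq_mk_iff {g h : SL(2, F)} : (g : PSL(2, F)) = h ↔ g = h ∨ g = -h := by
  rw [QuotientGroup.eq, Matrix.SpecialLinearGroup.mem_center_iff]
  constructor
  · rintro ⟨r, hr, hs⟩
    have hr : r = 1 ∨ r = -1 := by simpa using hr
    have hh : h = g * (g⁻¹ * h) := by group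
    rcases hr with rfl | rfl
    · left
      have : g⁻¹ * h = 1 := Subtype.ext (by rw [← hs]; simp)
      rw [hh, this, mul_one]
    · right
      have : g⁻¹ * h = -1 := by
        refine Subtype.ext ?_
        rw [← hs]
        ext i j; simp [Matrix.one_apply, Matrix.diagonal_apply]; split_ifs <;> simp
      rw [hh, this]; simp
  · rintro (rfl | rfl)
    · exact ⟨1, by simp, by simp⟩
    · refine ⟨-1, by simp, ?_⟩
      have : (-h)⁻¹ * h = -1 := by rw [inv_mul_eq_iff_eq_mul]; simp
      rw [this]
      ext i j; simp [Matrix.one_apply, Matrix.diagonal_apply]; split_ifs <;> simp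

lemma SL2.eq_iff {g h : SL(2, F)} :
    g = h ↔ g 0 0 = h 0 0 ∧ g 0 1 = h 0 1 ∧ g 1 0 = h 1 0 ∧ g 1 1 = h 1 1 := by
  refine (Matrix.SpecialLinearGroup.ext_iff g h).trans ?_
  simp [Fin.forall_fin_two, and_assoc]

lemma SL2.mul_apply (g h : SL(2, F)) (i j : Fin 2) :
    (g * h) i j = g i 0 * h 0 j + g i 1 * h 1 j := by
  simp [Matrix.mul_apply]

lemma SL2.neg_apply (g : SL(2, F)) (i j : Fin 2) : (-g) i j = -g i j := by
  simp

lemma SL2.one_entries : (1 : SL(2, F)) 0 0 = 1 ∧ (1 : SL(2, F)) 0 1 = 0 ∧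
    (1 : SL(2, F)) 1 0 = 0 ∧ (1 : SL(2, F)) 1 1 = 1 := by
  simp

lemma SL2.det_eq (g : SL(2, F)) : g 0 0 * g 1 1 - g 0 1 * g 1 0 = 1 := by
  rw [← Matrix.det_fin_two, g.det_coe]

lemma SL2.mul_self_of_trace_eq_zero {g : SL(2, F)} (h : g 0 0 + g 1 1 = 0) : g * g = -1 := by
  have hdet := SL2.det_eq g
  simp only [SL2.eq_iff, SL2.mul_apply, SL2.neg_apply, SL2.one_entries]
  refine ⟨?_, ?_, ?_, ?_⟩
  · linear_combination g 0 0 * h - hdet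
  · linear_combination g 0 1 * h
  · linear_combination g 1 0 * h
  · linear_combination g 1 1 * h - hdet

lemma SL2.mul_mul_self_of_trace_eq_one {g : SL(2, F)} (h : g 0 0 + g 1 1 = 1) :
    g * g * g = -1 := by
  have hdet := SL2.det_eq g
  have h11 : g 1 1 = 1 - g 0 0 := by linear_combination h
  rw [h11] at hdet
  simp only [SL2.eq_iff, SL2.mul_apply, SL2.neg_apply, SL2.one_entries, h11]
  refine ⟨?_, ?_, ?_, ?_⟩
  · linear_combination -(g 0 0 + 1) * hdet
  · linear_combination -g 0 1 * hdet
  · linear_combination -g 1 0 * hdet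
  · linear_combination (g 0 0 - 2) * hdet

lemma PSL2.mk_mul_self {g : SL(2, F)} (h : g 0 0 + g 1 1 = 0) :
    (g * g : PSL(2, F)) = 1 := by
  rw [← QuotientGroup.mk_mul, ← QuotientGroup.mk_one, PSL2.mk_eq_mk_iff]
  exact Or.inr (SL2.mul_self_of_trace_eq_zero h)

lemma PSL2.mk_mul_mul_self {g : SL(2, F)} (h : g 0 0 + g 1 1 = 1 ∨ g 0 0 + g 1 1 = -1) :
    (g * g * g : PSL(2, F)) = 1 := by
  rw [← QuotientGroup.mk_mul, ← QuotientGroup.mk_mul, ← QuotientGroup.mk_one,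
    PSL2.mk_eq_mk_iff]
  rcases h with h | h
  · exact Or.inr (SL2.mul_mul_self_of_trace_eq_one h)
  · left
    have := SL2.mul_mul_self_of_trace_eq_one (g := -g)
      (by simp only [SL2.neg_apply]; linear_combination -h)
    simpa using this

/-- The element of `SL₂(F)` with the given entries. -/
def SL2.of (a b c d : F) (h : a * d - b * c = 1) : SL(2, F) :=
  ⟨!![a, b; c, d], by rwa [Matrix.det_fin_two_of]⟩

lemma SL2.of_entries (a b c d : F) (h : a * d - b * c = 1) :
    SL2.of a b c d h 0 0 = a ∧ SL2.of a b c d h 0 1 = b ∧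
      SL2.of a b c d h 1 0 = c ∧ SL2.of a b c d h 1 1 = d := ⟨rfl, rfl, rfl, rfl⟩

/-- The upper unitriangular matrix with off-diagonal entry `b`. -/
def SL2.upper (b : F) : SL(2, F) := SL2.of 1 b 0 1 (by ring)

/-- The lower unitriangular matrix with off-diagonal entry `b`. -/
def SL2.lower (b : F) : SL(2, F) := SL2.of 1 0 b 1 (by ring)

lemma SL2.upper_entries (b : F) : SL2.upper b 0 0 = 1 ∧ SL2.upper b 0 1 = b ∧
    SL2.upper b 1 0 = 0 ∧ SL2.upper b 1 1 = 1 := ⟨rfl, rfl, rfl, rfl⟩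

lemma SL2.lower_entries (b : F) : SL2.lower b 0 0 = 1 ∧ SL2.lower b 0 1 = 0 ∧
    SL2.lower b 1 0 = b ∧ SL2.lower b 1 1 = 1 := ⟨rfl, rfl, rfl, rfl⟩

lemma SL2.upper_pow (b : F) (n : ℕ) : SL2.upper b ^ n = SL2.upper (n * b) := by
  induction n with
  | zero => simp [SL2.eq_iff, SL2.upper_entries]
  | succ n ih =>
    rw [pow_succ, ih]
    simp only [SL2.eq_iff, SL2.mul_apply, SL2.upper_entries]
    push_cast
    refine ⟨?_, ?_, ?_, ?_⟩ <;> ring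

lemma SL2.lower_pow (b : F) (n : ℕ) : SL2.lower b ^ n = SL2.lower (n * b) := by
  induction n with
  | zero => simp [SL2.eq_iff, SL2.lower_entries]
  | succ n ih =>
    rw [pow_succ, ih]
    simp only [SL2.eq_iff, SL2.mul_apply, SL2.lower_entries]
    push_cast
    refine ⟨?_, ?_, ?_, ?_⟩ <;> ring

/-- An element of `SL₂(F)` commuting up to sign with an upper and a lower unitriangular matrix
is trivial in `PSL₂(F)`. -/
lemma PSL2.mk_eq_one_of_commute {b : F} (hb : b ≠ 0) (h2 : (2 : F) ≠ 0) {g : SL(2, F)}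
    (hu : (SL2.upper b : PSL(2, F)) * g = g * SL2.upper b)
    (hl : (SL2.lower b : PSL(2, F)) * g = g * SL2.lower b) : (g : PSL(2, F)) = 1 := by
  rw [← QuotientGroup.mk_mul, ← QuotientGroup.mk_mul, PSL2.mk_eq_mk_iff] at hu hl
  have hdet := SL2.det_eq g
  simp only [SL2.eq_iff, SL2.mul_apply, SL2.neg_apply, SL2.upper_entries,
    SL2.lower_entries] at hu hl
  have h10 : g 1 0 = 0 := by
    rcases hu with ⟨hu, -⟩ | ⟨-, -, hu, -⟩
    · exact (mul_eq_zero_iff_left hb).mp (by linear_combination hu)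
    · exact (mul_eq_zero_iff_left h2).mp (by linear_combination hu)
  have h01 : g 0 1 = 0 := by
    rcases hl with ⟨hl, -⟩ | ⟨-, hl, -⟩
    · exact (mul_eq_zero_iff_left hb).mp (by linear_combination -hl)
    · exact (mul_eq_zero_iff_left h2).mp (by linear_combination hl)
  rw [h10, mul_zero, sub_zero] at hdet
  have h11 : g 1 1 = g 0 0 := by
    rcases hu with ⟨-, hu, -⟩ | ⟨hu, -⟩
    · exact mul_left_cancel₀ hb (by linear_combination hu)
    · have : g 0 0 = 0 := (mul_eq_zero_iff_left h2).mp (by linear_combination hu - b * h10)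
      simp [this] at hdet
  rw [h11, mul_self_eq_one_iff] at hdet
  rw [← QuotientGroup.mk_one, PSL2.mk_eq_mk_iff]
  simp only [SL2.eq_iff, SL2.neg_apply, SL2.one_entries, h10, h01, h11]
  simpa using hdet

lemma SL2.eq_top_of_unitriangular_mem {H : Subgroup SL(2, F)} (hu : ∀ b, SL2.upper b ∈ H)
    (hl : ∀ b, SL2.lower b ∈ H) : H = ⊤ := by
  rw [eq_top_iff]
  rintro g -
  refine SL2.transvection_induction (· ∈ H) (fun i j hij c => ?_) (fun _ _ => H.mul_mem) g
  fin_cases i <;> fin_cases j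
  · exact absurd rfl hij
  · convert! hu c using 1
    refine SL2.eq_iff.mpr ?_
    simp [SL2.upper_entries, transvection_coe]
  · convert! hl c using 1
    refine SL2.eq_iff.mpr ?_
    simp [SL2.lower_entries, transvection_coe]
  · exact absurd rfl hij

/-- The companion matrix of the sixth cyclotomic polynomial. -/
def SL2.rho : SL(2, F) := SL2.of 0 (-1) 1 1 (by ring)

lemma SL2.rho_entries : (SL2.rho : SL(2, F)) 0 0 = 0 ∧ (SL2.rho : SL(2, F)) 0 1 = -1 ∧
    (SL2.rho : SL(2, F)) 1 0 = 1 ∧ (SL2.rho : SL(2, F)) 1 1 = 1 := ⟨rfl, rfl, rfl, rfl⟩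

lemma SL2.rho_conj_upper (b : F) :
    SL2.rho * SL2.upper b * SL2.rho⁻¹ = SL2.lower (-b) := by
  rw [mul_inv_eq_iff_eq_mul]
  simp only [SL2.eq_iff, SL2.mul_apply, SL2.rho_entries, SL2.upper_entries, SL2.lower_entries]
  refine ⟨?_, ?_, ?_, ?_⟩ <;> ring

end SL2

section ZMod

variable {p : ℕ} [Fact p.Prime]

lemma SL2.eq_top_of_rho_mem_of_upper_mem {H : Subgroup SL(2, ZMod p)} (hrho : SL2.rho ∈ H)
    {k : ZMod p} (hk : k ≠ 0) (hu : SL2.upper k ∈ H) : H = ⊤ := by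
  have hu' : ∀ b, SL2.upper b ∈ H := by
    intro b
    have := H.pow_mem hu (b / k).val
    rwa [SL2.upper_pow, ZMod.natCast_zmod_val, div_mul_cancel₀ _ hk] at this
  refine SL2.eq_top_of_unitriangular_mem hu' fun b => ?_
  rw [← neg_neg b, ← SL2.rho_conj_upper]
  exact H.mul_mem (H.mul_mem hrho (hu' _)) (H.inv_mem hrho)

lemma PSL2.noSmallClass (h2 : (2 : ZMod p) ≠ 0) (h3 : (3 : ZMod p) ≠ 0) :
    NoSmallClass PSL(2, ZMod p) := by
  intro S hfin hS hN g hg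
  induction g using QuotientGroup.induction_on with | H g => ?_
  have h6 : ((6 : ℕ) : ZMod p) * 1 ≠ 0 := by
    intro h
    have : (2 : ZMod p) * 3 = 0 := by rw [← h]; norm_num
    simp_all
  have key (u : PSL(2, ZMod p)) : u ^ 6 * g = g * u ^ 6 :=
    pow_six_mul_comm_of_mem_normalizer hfin hS (by simp [hN]) hg
  refine PSL2.mk_eq_one_of_commute h6 h2 ?_ ?_
  · rw [← SL2.upper_pow]; exact key (SL2.upper (1 : ZMod p))
  · rw [← SL2.lower_pow]; exact key (SL2.lower (1 : ZMod p))

end ZMod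

section NormForm

variable {p : ℕ} [Fact p.Prime]

lemma ZMod.exists_sq_add_mul_add_sq_eq (h2 : (2 : ZMod p) ≠ 0) (h3 : (3 : ZMod p) ≠ 0)
    (n : ZMod p) : ∃ a c : ZMod p, a ^ 2 + a * c + c ^ 2 = n := by
  have hodd : Fintype.card (ZMod p) % 2 = 1 := by
    rw [ZMod.card]
    refine ((Fact.out : p.Prime).eq_two_or_odd).resolve_left ?_
    rintro rfl
    exact h2 rfl
  obtain ⟨u, v, huv⟩ := FiniteField.exists_root_sum_quadratic
    (f := (Polynomial.X ^ 2 : Polynomial (ZMod p)))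
    (g := Polynomial.C 3 * Polynomial.X ^ 2 + Polynomial.C 0 * Polynomial.X
      + Polynomial.C (-4 * n))
    (Polynomial.degree_X_pow 2) (Polynomial.degree_quadratic h3) hodd
  simp only [Polynomial.eval_pow, Polynomial.eval_X, Polynomial.eval_add, Polynomial.eval_mul,
    Polynomial.eval_C] at huv
  have h4 : (4 : ZMod p) ≠ 0 := by
    rw [show (4 : ZMod p) = 2 * 2 by norm_num]; exact mul_ne_zero h2 h2
  refine ⟨(u - v) / 2, v, ?_⟩
  field_simp
  linear_combination huv

lemma ZMod.card_le_card_sq_add_mul_add_sq_eq (h2 : (2 : ZMod p) ≠ 0)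
    (hm : ∀ m : ZMod p, m ^ 2 + m + 1 ≠ 0) {n : ZMod p} (hn : n ≠ 0) :
    p + 1 ≤ (Finset.univ.filter
      fun q : ZMod p × ZMod p => q.1 ^ 2 + q.1 * q.2 + q.2 ^ 2 = n).card := by
  have h3 : (3 : ZMod p) ≠ 0 := by
    have := hm 1
    norm_num at this
    exact this
  obtain ⟨a, c, hac⟩ := ZMod.exists_sq_add_mul_add_sq_eq h2 h3 n
  have hcard : p + 1 = (Finset.univ : Finset (Option (ZMod p))).card := by
    rw [Finset.card_univ, Fintype.card_option, ZMod.card]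
  -- coordinates of the norm-one quotient of `z` by its conjugate, for `z = m + ω` or `z = 1`
  let u : Option (ZMod p) → ZMod p × ZMod p
    | none => (1, 0)
    | some m => ((m ^ 2 - 1) / (m ^ 2 + m + 1), (2 * m + 1) / (m ^ 2 + m + 1))
  have hu : ∀ m, (u m).1 ^ 2 + (u m).1 * (u m).2 + (u m).2 ^ 2 = 1 := by
    rintro (_ | m)
    · simp [u]
    · have := hm m
      simp only [u]
      generalize hD : m ^ 2 + m + 1 = D at this
      field_simp
      rw [← hD]
      ring
  have hinj : Function.Injective u := by
    rintro (_ | m) (_ | m') h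
    · rfl
    · have := hm m'
      simp only [u, Prod.mk.injEq, eq_div_iff this] at h
      exact absurd (by linear_combination 2 * h.1 + h.2) h3
    · have := hm m
      simp only [u, Prod.mk.injEq, div_eq_iff this] at h
      exact absurd (by linear_combination -2 * h.1 - h.2) h3
    · have h0 := hm m
      have h0' := hm m'
      simp only [u, Prod.mk.injEq, div_eq_div_iff h0 h0'] at h
      obtain ⟨h1, h1'⟩ := h
      have : 3 * (m ^ 2 + m + 1) * (m' ^ 2 + m' + 1) * (m - m') = 0 := by
        linear_combination (m + m' + 1 - (m * m' - 1)) * h1 -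
          (2 * (m * m' - 1) + (m + m' + 1)) * h1'
      simp only [mul_eq_zero, h3, h0, h0', false_or, sub_eq_zero] at this
      rw [this]
  rw [hcard]
  refine Finset.card_le_card_of_injOn
    (fun m => (a * (u m).1 - c * (u m).2, a * (u m).2 + c * (u m).1 + c * (u m).2)) ?_ ?_
  · intro m _
    simp only [Finset.coe_filter, Finset.mem_univ, true_and, Set.mem_ofPred_eq]
    linear_combination hac + (a ^ 2 + a * c + c ^ 2) * hu m
  · intro m _ m' _ h
    simp only [Prod.mk.injEq] at h
    obtain ⟨h1, h1'⟩ := h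
    refine hinj (Prod.ext ?_ ?_)
    · exact mul_left_cancel₀ hn (by rw [← hac]; linear_combination (a + c) * h1 + c * h1')
    · exact mul_left_cancel₀ hn (by rw [← hac]; linear_combination a * h1' - c * h1)

lemma ZMod.sq_add_self_add_one_ne_zero (h3 : 3 ∣ p + 1) (m : ZMod p) : m ^ 2 + m + 1 ≠ 0 := by
  intro h
  have hm3 : m ^ 3 = 1 := by linear_combination (m - 1) * h
  obtain ⟨k, hk⟩ : ∃ k, p = 3 * k + 2 := ⟨p / 3, by omega⟩
  have hm2 : m ^ 2 = m := by
    calc m ^ 2 = m ^ (3 * k + 2) := by rw [pow_add, pow_mul, hm3, one_pow, one_mul]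
      _ = m ^ p := by rw [← hk]
      _ = m := ZMod.pow_card m
  have hm1 : m = 1 := by linear_combination hm3 - m * hm2 - hm2
  have h30 : ((3 : ℕ) : ZMod p) = 0 := by
    rw [hm1] at h
    push_cast
    linear_combination h
  rw [ZMod.natCast_eq_zero_iff, Nat.prime_dvd_prime_iff_eq Fact.out Nat.prime_three] at h30
  omega

lemma ZMod.three_ne_zero (h3 : 3 ∣ p + 1) : (3 : ZMod p) ≠ 0 := by
  have := ZMod.sq_add_self_add_one_ne_zero h3 1
  norm_num at this
  exact this

end NormForm

section Coclique

variable {p : ℕ}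

/-- The elements `t` of `SL₂(p)` of trace zero such that `rho * t` has trace `ε`. -/
def SL2.traceSet (p : ℕ) [Fact p.Prime] (ε : ZMod p) : Finset SL(2, ZMod p) :=
  Finset.univ.filter fun t => t 1 1 = -t 0 0 ∧ t 0 1 = t 0 0 + t 1 0 + ε

variable [Fact p.Prime]

lemma SL2.mem_traceSet {ε : ZMod p} {t : SL(2, ZMod p)} :
    t ∈ SL2.traceSet p ε ↔ t 1 1 = -t 0 0 ∧ t 0 1 = t 0 0 + t 1 0 + ε := by
  simp [SL2.traceSet]

lemma SL2.le_card_traceSet (h2 : (2 : ZMod p) ≠ 0) (h3 : 3 ∣ p + 1) {ε : ZMod p}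
    (hε : ε ^ 2 ≠ 3) : p + 1 ≤ (SL2.traceSet p ε).card := by
  have hm := ZMod.sq_add_self_add_one_ne_zero h3
  have h30 : (3 : ZMod p) ≠ 0 := ZMod.three_ne_zero h3
  have hn : (ε ^ 2 - 3) / 3 ≠ 0 := div_ne_zero (sub_ne_zero.mpr hε) h30
  refine (ZMod.card_le_card_sq_add_mul_add_sq_eq h2 hm hn).trans ?_
  have hdet : ∀ q : {q : ZMod p × ZMod p // q.1 ^ 2 + q.1 * q.2 + q.2 ^ 2 = (ε ^ 2 - 3) / 3},
      (q.1.1 + ε / 3) * -(q.1.1 + ε / 3) -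
        ((q.1.1 + ε / 3) + (q.1.2 - 2 * ε / 3) + ε) * (q.1.2 - 2 * ε / 3) = 1 := by
    rintro ⟨⟨a, c⟩, h⟩
    simp only at h ⊢
    field_simp at h ⊢
    linear_combination -3 * h
  rw [← Fintype.card_subtype, ← Finset.card_univ]
  refine Finset.card_le_card_of_injOn (fun q => SL2.of _ _ _ _ (hdet q)) ?_ ?_
  · intro q _
    simp only [Finset.mem_coe, SL2.mem_traceSet, SL2.of_entries, and_self]
  · intro q _ q' _ h
    simp only [SL2.eq_iff, SL2.of_entries] at h
    exact Subtype.ext (Prod.ext (by linear_combination h.1) (by linear_combination h.2.2.1))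

lemma SL2.disjoint_traceSet {ε ε' : ZMod p} (h : ε ≠ ε') :
    Disjoint (SL2.traceSet p ε) (SL2.traceSet p ε') := by
  rw [Finset.disjoint_left]
  intro t ht ht'
  rw [SL2.mem_traceSet] at ht ht'
  exact h (by linear_combination ht'.2 - ht.2)

lemma SL2.mk_mem_smallProductSet_of_mem_traceSet {ε : ZMod p} (hε : ε = 0 ∨ ε = 1 ∨ ε = -1)
    {t : SL(2, ZMod p)} (ht : t ∈ SL2.traceSet p ε) :
    (t : PSL(2, ZMod p)) ∈ smallProductSet ((SL2.rho : SL(2, ZMod p)) : PSL(2, ZMod p)) := by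
  rw [SL2.mem_traceSet] at ht
  have htr : (SL2.rho * t : SL(2, ZMod p)) 0 0 + (SL2.rho * t : SL(2, ZMod p)) 1 1 = ε := by
    simp only [SL2.mul_apply, SL2.rho_entries]
    linear_combination ht.1 + ht.2
  refine Or.inr ⟨PSL2.mk_mul_self (by rw [ht.1, add_neg_cancel]), ?_⟩
  rw [← QuotientGroup.mk_mul]
  rcases hε with rfl | hε
  · exact Or.inl (PSL2.mk_mul_self htr)
  · exact Or.inr (PSL2.mk_mul_mul_self (htr ▸ hε))

lemma PSL2.eq_top_of_smallProductSet_subset (h2 : (2 : ZMod p) ≠ 0) (h3 : (3 : ZMod p) ≠ 0)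
    (hsq : IsSquare (-1 : ZMod p) ∨ IsSquare (-2 : ZMod p)) {M : Subgroup PSL(2, ZMod p)}
    (hM : smallProductSet ((SL2.rho : SL(2, ZMod p)) : PSL(2, ZMod p)) ⊆ M) : M = ⊤ := by
  set H := M.comap (QuotientGroup.mk' (Subgroup.center SL(2, ZMod p))) with hH
  have hrho : SL2.rho ∈ H := hM (Or.inl (by simp))
  have htr : ∀ {ε : ZMod p}, (ε = 0 ∨ ε = 1 ∨ ε = -1) → ∀ {t}, t ∈ SL2.traceSet p ε → t ∈ H :=
    fun hε _ ht => hM (SL2.mk_mem_smallProductSet_of_mem_traceSet hε ht)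
  suffices hk : ∃ k : ZMod p, k ≠ 0 ∧ SL2.upper k ∈ H by
    obtain ⟨k, hk, hu⟩ := hk
    have := SL2.eq_top_of_rho_mem_of_upper_mem hrho hk hu
    rw [eq_top_iff]
    rintro g -
    induction g using QuotientGroup.induction_on with | H g => ?_
    exact (this ▸ Subgroup.mem_top g : g ∈ H)
  rcases hsq with ⟨i, hi⟩ | ⟨j, hj⟩
  · let t := SL2.of i i 0 (-i) (by linear_combination hi)
    let s := SL2.of i (i + 1) 0 (-i) (by linear_combination hi)
    have ht : t ∈ H := htr (ε := 0) (by simp) (by simp [SL2.mem_traceSet, t, SL2.of_entries])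
    have hs : s ∈ H := htr (ε := 1) (by simp) (by simp [SL2.mem_traceSet, s, SL2.of_entries])
    refine ⟨i, ?_, ?_⟩
    · rintro rfl
      simp at hi
    · convert! H.mul_mem (H.mul_mem ht ht) (H.mul_mem hs ht) using 1
      simp only [SL2.eq_iff, SL2.mul_apply, SL2.upper_entries, t, s, SL2.of_entries]
      refine ⟨?_, ?_, ?_, ?_⟩
      · linear_combination (i * i - 1) * hi
      · linear_combination (-i) * hi
      · ring
      · linear_combination (i * i - 1) * hi
  · obtain ⟨a, c, hac⟩ := ZMod.exists_sq_add_mul_add_sq_eq h2 h3 (-1)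
    let t := SL2.of (j + 1) j (-2) (-(j + 1)) (by linear_combination hj)
    let r := SL2.of a (a + c) c (-a) (by linear_combination -hac)
    let d := SL2.of (j - 1) (-2) 2 (j + 1) (by linear_combination -hj)
    have ht : t ∈ H := htr (ε := 1) (by simp)
      (by simp only [SL2.mem_traceSet, t, SL2.of_entries, true_and]; ring)
    have hr : r ∈ H := htr (ε := 0) (by simp)
      (by simp only [SL2.mem_traceSet, r, SL2.of_entries, true_and]; ring)
    have hrd : -(r * d) ∈ H := by
      refine htr (ε := 0) (by simp) ?_
      simp only [SL2.mem_traceSet, SL2.neg_apply, SL2.mul_apply, r, d, SL2.of_entries]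
      constructor <;> ring
    refine ⟨j, ?_, ?_⟩
    · rintro rfl
      simp [h2] at hj
    · have hrr : r * r = -1 := SL2.mul_self_of_trace_eq_zero
        (by simp only [r, SL2.of_entries, add_neg_cancel])
      have hdt : SL2.upper j = d * t := by
        simp only [SL2.eq_iff, SL2.mul_apply, SL2.upper_entries, t, d, SL2.of_entries]
        refine ⟨?_, ?_, ?_, ?_⟩
        · linear_combination hj
        · linear_combination hj
        · ring
        · linear_combination -hj
      convert! H.mul_mem (H.mul_mem hr hrd) ht using 1
      rw [hdt, mul_neg, ← mul_assoc, hrr]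
      simp

/-- Preimages in `SL₂(p)` of elements of `smallProductSet rho`. -/
def SL2.smallProductLifts (p : ℕ) [Fact p.Prime] : Finset SL(2, ZMod p) :=
  (SL2.traceSet p 0 ∪ SL2.traceSet p 1 ∪ SL2.traceSet p (-1)) ∪
    {1, -1, SL2.rho, -SL2.rho, SL2.rho⁻¹, -SL2.rho⁻¹}

lemma SL2.le_card_smallProductLifts (h2 : (2 : ZMod p) ≠ 0) (h3 : 3 ∣ p + 1) :
    3 * (p + 1) + 6 ≤ (SL2.smallProductLifts p).card := by
  have h30 : (3 : ZMod p) ≠ 0 := ZMod.three_ne_zero h3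
  have h11 : (1 : ZMod p) ≠ -1 := fun h => h2 (by linear_combination h)
  have hinv : (SL2.rho : SL(2, ZMod p))⁻¹ = SL2.of 1 1 (-1) 0 (by ring) := by
    rw [inv_eq_iff_mul_eq_one]
    simp only [SL2.eq_iff, SL2.mul_apply, SL2.rho_entries, SL2.of_entries, SL2.one_entries]
    refine ⟨?_, ?_, ?_, ?_⟩ <;> ring
  have hsix :
      ({1, -1, SL2.rho, -SL2.rho, SL2.rho⁻¹, -SL2.rho⁻¹} : Finset SL(2, ZMod p)).card = 6 := by
    rw [hinv]
    repeat rw [Finset.card_insert_of_notMem]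
    · rw [Finset.card_singleton]
    all_goals
      simp only [Finset.mem_insert, Finset.mem_singleton, SL2.eq_iff, SL2.neg_apply,
        SL2.rho_entries, SL2.of_entries, SL2.one_entries]
      simp [h11, h11.symm]
  have hdisj : Disjoint (SL2.traceSet p 0 ∪ SL2.traceSet p 1 ∪ SL2.traceSet p (-1))
      {1, -1, SL2.rho, -SL2.rho, SL2.rho⁻¹, -SL2.rho⁻¹} := by
    rw [Finset.disjoint_right, hinv]
    simp only [Finset.mem_insert, Finset.mem_singleton, Finset.mem_union, SL2.mem_traceSet]
    rintro t (rfl | rfl | rfl | rfl | rfl | rfl) <;>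
      simp only [SL2.neg_apply, SL2.rho_entries, SL2.of_entries, SL2.one_entries] <;>
      simp [h11, h11.symm]
  have h0 := SL2.le_card_traceSet h2 h3 (ε := 0) (by simpa using h30.symm)
  have h13 : (1 : ZMod p) ≠ 3 := fun h => h2 (by linear_combination -h)
  have h1 := SL2.le_card_traceSet h2 h3 (ε := 1) (by simpa using h13)
  have h1' := SL2.le_card_traceSet h2 h3 (ε := -1) (by simpa using h13)
  rw [SL2.smallProductLifts, Finset.card_union_of_disjoint hdisj, hsix,
    Finset.card_union_of_disjoint,
    Finset.card_union_of_disjoint (SL2.disjoint_traceSet zero_ne_one)]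
  · omega
  · rw [Finset.disjoint_union_left]
    exact ⟨SL2.disjoint_traceSet (by simp), SL2.disjoint_traceSet h11⟩

lemma PSL2.card_le_two_mul_card_image_mk (s : Finset SL(2, ZMod p)) :
    s.card ≤ 2 * ((fun g : SL(2, ZMod p) => (g : PSL(2, ZMod p))) '' s).ncard := by
  classical
  rw [← Finset.coe_image, Set.ncard_coe_finset]
  refine Finset.card_le_mul_card_image s 2 fun b hb => ?_
  obtain ⟨g, -, rfl⟩ := Finset.mem_image.mp hb
  refine (Finset.card_le_card (t := {g, -g}) fun h hh => ?_).trans Finset.card_le_two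
  simpa using PSL2.mk_eq_mk_iff.mp (Finset.mem_filter.mp hh).2

lemma PSL2.le_two_mul_ncard_smallProductSet (h2 : (2 : ZMod p) ≠ 0) (h3 : 3 ∣ p + 1) :
    3 * (p + 1) + 6 ≤ 2 * (smallProductSet ((SL2.rho : SL(2, ZMod p)) : PSL(2, ZMod p))).ncard := by
  refine ((SL2.le_card_smallProductLifts h2 h3).trans
    (PSL2.card_le_two_mul_card_image_mk _)).trans ?_
  refine Nat.mul_le_mul_left 2 (Set.ncard_le_ncard ?_ (Set.toFinite _))
  have hneg (g : SL(2, ZMod p)) : ((-g : SL(2, ZMod p)) : PSL(2, ZMod p)) = g :=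
    PSL2.mk_eq_mk_iff.mpr (Or.inr rfl)
  rintro _ ⟨g, hg, rfl⟩
  simp only [SL2.smallProductLifts, Finset.coe_union, Finset.coe_insert, Finset.coe_singleton] at hg
  rcases hg with ((hg | hg) | hg) | hg
  · exact SL2.mk_mem_smallProductSet_of_mem_traceSet (by simp) hg
  · exact SL2.mk_mem_smallProductSet_of_mem_traceSet (by simp) hg
  · exact SL2.mk_mem_smallProductSet_of_mem_traceSet (by simp) hg
  · left
    rcases hg with rfl | rfl | rfl | rfl | rfl | rfl <;> simp [hneg]

end Coclique

lemma IsCoclique.exists_isMaximalCoclique_superset {G : Type*} [Group G] [Finite G] {A : Set G}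
    (hA : IsCoclique A) : ∃ B, A ⊆ B ∧ IsMaximalCoclique B := by
  obtain ⟨B, hAB, hB⟩ := Finite.exists_le_maximal hA
  exact ⟨B, hAB, hB.prop, fun C hC hBC => hB.eq_of_subset hC hBC⟩

theorem exists_large_exceptional_maximal_coclique (p : ℕ) (hp : p.Prime)
    (hmod : p % 40 = 3 ∨ p % 40 = 37 ∨ p % 40 = 13 ∨ p % 40 = 27)
    (h3 : 3 ∣ p + 1) :
    ∃ A : Set PSL(2, ZMod p), IsMaximalCoclique A ∧
      3 * (p + 1) + 6 ≤ 2 * A.ncard ∧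
      (∀ M : Subgroup PSL(2, ZMod p), IsCoatom M → A ≠ (M : Set PSL(2, ZMod p))) ∧
      A ≠ {g : PSL(2, ZMod p) | orderOf g = 2} := by
  have : Fact p.Prime := ⟨hp⟩
  have hp2 : p ≠ 2 := by omega
  have h2 : (2 : ZMod p) ≠ 0 := by
    have : ((2 : ℕ) : ZMod p) ≠ 0 := by
      rwa [Ne, ZMod.natCast_eq_zero_iff, Nat.prime_dvd_prime_iff_eq hp Nat.prime_two]
    exact_mod_cast this
  have h30 : (3 : ZMod p) ≠ 0 := ZMod.three_ne_zero h3
  have hsq : IsSquare (-1 : ZMod p) ∨ IsSquare (-2 : ZMod p) := by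
    rw [ZMod.exists_sq_eq_neg_one_iff, ZMod.exists_sq_eq_neg_two_iff hp2]
    omega
  have hrho3 : ((SL2.rho : SL(2, ZMod p)) : PSL(2, ZMod p)) * (SL2.rho : SL(2, ZMod p)) *
      (SL2.rho : SL(2, ZMod p)) = 1 :=
    PSL2.mk_mul_mul_self (g := SL2.rho) (Or.inl (by simp [SL2.rho_entries]))
  have hrho1 : ((SL2.rho : SL(2, ZMod p)) : PSL(2, ZMod p)) ≠ 1 := by
    rw [← QuotientGroup.mk_one, Ne, PSL2.mk_eq_mk_iff]
    simp [SL2.eq_iff, SL2.neg_apply, SL2.one_entries, SL2.rho_entries]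
  have : Nontrivial PSL(2, ZMod p) := ⟨_, _, hrho1⟩
  obtain ⟨A, hsub, hA⟩ :=
    ((PSL2.noSmallClass h2 h30).isCoclique_smallProductSet hrho3).exists_isMaximalCoclique_superset
  refine ⟨A, hA, ?_, ?_, ?_⟩
  · exact (PSL2.le_two_mul_ncard_smallProductSet h2 h3).trans
      (Nat.mul_le_mul_left 2 (Set.ncard_le_ncard hsub (Set.toFinite _)))
  · rintro M hM rfl
    exact hM.1 (PSL2.eq_top_of_smallProductSet_subset h2 h30 hsq hsub)
  · rintro rfl
    have h1 : (1 : PSL(2, ZMod p)) ∈ {g : PSL(2, ZMod p) | orderOf g = 2} :=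
      hsub (Or.inl (by simp))
    simp at h1
end

section
/- Let F be a finite field of odd cardinality q, let V be a 3-dimensional vector space over F, and let Q be a quadratic form on V whose polar form B(u, w) = Q(u + w) − Q(u) − Q(w) is nondegenerate on V. Then the number of 2-dimensional subspaces U ≤ V such that the restriction of B to U is degenerate (i.e. there is a nonzero u ∈ U with B(u, w) = 0 for all w ∈ U) is exactly q + 1. -/
theorem FiniteField.two_ne_zero_of_odd_card {F : Type*} [Field F] [Fintype F]
    (hodd : Odd (Fintype.card F)) : (2 : F) ≠ 0 :=
  Ring.two_ne_zero fun h => by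
    have := FiniteField.even_card_iff_char_two.mp h
    rw [Nat.odd_iff] at hodd
    omega

open QuadraticMap in
/-- A nondegenerate ternary quadratic form over a finite field of odd order has an isotropic
vector. -/
theorem QuadraticForm.exists_isotropic_of_finrank_eq_three {F V : Type*} [Field F] [Fintype F]
    [AddCommGroup V] [Module F V] [FiniteDimensional F V] (hodd : Odd (Fintype.card F))
    (hV : Module.finrank F V = 3) (Q : QuadraticForm F V)
    (hB : ∀ u : V, (∀ w : V, polar Q u w = 0) → u = 0) :
    ∃ e : V, e ≠ 0 ∧ Q e = 0 := by
  have h2 : (2 : F) ≠ 0 := FiniteField.two_ne_zero_of_odd_card hodd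
  let _ : Invertible (2 : F) := invertibleOfNonzero h2
  obtain ⟨v, hv⟩ := LinearMap.BilinForm.exists_orthogonal_basis (B := Q.polarBilin)
    ⟨fun x y => polar_comm Q x y⟩
  let i (k : Fin 3) : Fin (Module.finrank F V) := Fin.cast hV.symm k
  have hi : Function.Injective i := Fin.cast_injective hV.symm
  have hne (k) : Q (v k) ≠ 0 := fun h =>
    hv.not_isOrtho_basis_self_of_separatingLeft hB k (by simp [polar_self, h])
  have horth {j k} (h : j ≠ k) : polar Q (v (i j)) (v (i k)) = 0 := hv (hi.ne h)
  have hdeg (a b : F) (ha : a ≠ 0) :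
      (Polynomial.C a * Polynomial.X ^ 2 + Polynomial.C b).degree = 2 := by
    simpa using Polynomial.degree_quadratic (b := 0) (c := b) ha
  obtain ⟨x, y, hxy⟩ := FiniteField.exists_root_sum_quadratic
    (hdeg _ (Q (v (i 2))) (hne (i 0))) (hdeg _ 0 (hne (i 1))) (Nat.odd_iff.mp hodd)
  refine ⟨x • v (i 0) + y • v (i 1) + v (i 2), fun h => ?_, ?_⟩
  · have := congrArg (fun w => v.repr w (i 2)) h
    simp [hi.eq_iff] at this
  · simp only [Polynomial.eval_add, Polynomial.eval_mul, Polynomial.eval_C, Polynomial.eval_pow,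
      Polynomial.eval_X] at hxy
    simp only [QuadraticMap.map_add Q, QuadraticMap.map_smul, polar_add_left, polar_smul_left,
      polar_smul_right, smul_eq_mul, horth (show (0 : Fin 3) ≠ 1 by decide),
      horth (show (0 : Fin 3) ≠ 2 by decide), horth (show (1 : Fin 3) ≠ 2 by decide)]
    linear_combination hxy

open QuadraticMap in
/-- A nondegenerate isotropic ternary quadratic form is `x * y + c * z ^ 2` in suitable
coordinates. -/
theorem QuadraticForm.exists_hyperbolic_triple {F V : Type*} [Field F]
    [AddCommGroup V] [Module F V] [FiniteDimensional F V]
    (hV : Module.finrank F V = 3) (Q : QuadraticForm F V)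
    (hB : ∀ u : V, (∀ w : V, polar Q u w = 0) → u = 0)
    {e : V} (he : e ≠ 0) (hQe : Q e = 0) :
    ∃ f g : V, Q f = 0 ∧ polar Q e f = 1 ∧ polar Q e g = 0 ∧ polar Q f g = 0 ∧ Q g ≠ 0 ∧
      ∀ w : V, ∃ x y z : F, w = x • e + y • f + z • g := by
  obtain ⟨f₀, hf₀⟩ : ∃ w, polar Q e w ≠ 0 := by
    by_contra! h
    exact he (hB e h)
  have hee : polar Q e e = 0 := by simp [polar_self, hQe]
  obtain ⟨f, hQf, hef⟩ : ∃ f, Q f = 0 ∧ polar Q e f = 1 := by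
    set f₁ := (polar Q e f₀)⁻¹ • f₀
    have h₁ : polar Q e f₁ = 1 := by simp [f₁, polar_smul_right, hf₀]
    refine ⟨f₁ - Q f₁ • e, ?_, ?_⟩
    · rw [sub_eq_add_neg, ← neg_smul]
      simp [QuadraticMap.map_add Q, QuadraticMap.map_smul, polar_smul_right, polar_comm Q f₁ e,
        h₁, hQe]
    · simp [polar_sub_right, polar_smul_right, h₁, hee]
  have hff : polar Q f f = 0 := by simp [polar_self, hQf]
  have hfe : polar Q f e = 1 := by rw [polar_comm, hef]
  obtain ⟨g, hg, hg0⟩ := Submodule.exists_mem_ne_zero_of_ne_bot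
    (LinearMap.ker_ne_bot_of_finrank_lt (f := (Q.polarBilin e).prod (Q.polarBilin f))
      (by simp [hV]))
  obtain ⟨heg, hfg⟩ : polar Q e g = 0 ∧ polar Q f g = 0 := by simpa using hg
  have hli : LinearIndependent F ![e, f, g] := by
    rw [Fintype.linearIndependent_iff]
    intro c hc
    simp only [Fin.sum_univ_three, Matrix.cons_val] at hc
    have h0 : c 0 = 0 := by
      simpa [polar_add_right, polar_smul_right, hfe, hff, hfg] using congrArg (polar Q f) hc
    have h1 : c 1 = 0 := by
      simpa [polar_add_right, polar_smul_right, hee, hef, heg] using congrArg (polar Q e) hc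
    have h2 : c 2 = 0 := by simpa [h0, h1, hg0] using hc
    intro k
    fin_cases k <;> assumption
  have hspan (w : V) : ∃ x y z : F, w = x • e + y • f + z • g := by
    let b := basisOfLinearIndependentOfCardEqFinrank hli (by simp [hV])
    refine ⟨b.repr w 0, b.repr w 1, b.repr w 2, ?_⟩
    conv_lhs => rw [← b.sum_repr w]
    simp [b, Fin.sum_univ_three]
  refine ⟨f, g, hQf, hef, heg, hfg, fun hQg => hg0 (hB g fun w => ?_), hspan⟩
  obtain ⟨x, y, z, rfl⟩ := hspan w
  simp [polar_add_right, polar_smul_right, polar_comm Q g e, polar_comm Q g f, heg, hfg,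
    polar_self, hQg]

open QuadraticMap in
/-- For a nondegenerate ternary form, the degenerate planes are the orthogonal complements of
isotropic vectors. -/
theorem QuadraticForm.degenerate_plane_iff {F V : Type*} [Field F]
    [AddCommGroup V] [Module F V] [FiniteDimensional F V] (h2 : (2 : F) ≠ 0)
    (hV : Module.finrank F V = 3) (Q : QuadraticForm F V)
    (hB : ∀ u : V, (∀ w : V, polar Q u w = 0) → u = 0) (U : Submodule F V) :
    (Module.finrank F U = 2 ∧ ∃ u ∈ U, u ≠ 0 ∧ ∀ w ∈ U, polar Q u w = 0) ↔
      ∃ u : V, u ≠ 0 ∧ Q u = 0 ∧ LinearMap.ker (Q.polarBilin u) = U := by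
  have hfin {u : V} (hu : u ≠ 0) : Module.finrank F (LinearMap.ker (Q.polarBilin u)) = 2 := by
    have := Module.Dual.finrank_ker_add_one_of_ne_zero (f := Q.polarBilin u)
      fun h => hu (hB u fun w => by simpa using LinearMap.congr_fun h w)
    omega
  constructor
  · rintro ⟨hU, u, huU, hu, h⟩
    refine ⟨u, hu, by simpa [polar_self, h2] using h u huU, ?_⟩
    exact (Submodule.eq_of_le_of_finrank_eq (fun w hw => h w hw) (hU.trans (hfin hu).symm)).symm
  · rintro ⟨u, hu, hQu, rfl⟩
    exact ⟨hfin hu, u, by simp [polar_self, hQu], hu, fun w hw => hw⟩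

open QuadraticMap in
theorem card_degenerate_two_spaces {F V : Type*} [Field F] [Fintype F]
    [AddCommGroup V] [Module F V] [FiniteDimensional F V]
    (q : ℕ) (hq : q = Fintype.card F) (hodd : Odd q)
    (hV : Module.finrank F V = 3)
    (Q : QuadraticForm F V)
    (hB : ∀ u : V, (∀ w : V, QuadraticMap.polar Q u w = 0) → u = 0) :
    {U : Submodule F V | Module.finrank F U = 2 ∧
       ∃ u ∈ U, u ≠ 0 ∧ ∀ w ∈ U, QuadraticMap.polar Q u w = 0}.ncard = q + 1 := by
  subst hq
  have h2 : (2 : F) ≠ 0 := FiniteField.two_ne_zero_of_odd_card hodd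
  obtain ⟨e, he, hQe⟩ := Q.exists_isotropic_of_finrank_eq_three hodd hV hB
  obtain ⟨f, g, hQf, hef, heg, hfg, hQg, hspan⟩ := Q.exists_hyperbolic_triple hV hB he hQe
  have hfe : polar Q f e = 1 := by rw [polar_comm, hef]
  have hge : polar Q g e = 0 := by rw [polar_comm, heg]
  have hgf : polar Q g f = 0 := by rw [polar_comm, hfg]
  have hee : polar Q e e = 0 := by simp [polar_self, hQe]
  have hff : polar Q f f = 0 := by simp [polar_self, hQf]
  have hgg : polar Q g g = 2 * Q g := by simp [polar_self]
  have hQ (x y z : F) : Q (x • e + y • f + z • g) = x * y + Q g * z ^ 2 := by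
    simp only [QuadraticMap.map_add Q, QuadraticMap.map_smul, polar_add_left, polar_smul_left,
      polar_smul_right, smul_eq_mul, hQe, hQf, hef, heg, hfg]
    ring
  let p (t : F) : V := (1 : F) • e + (-(Q g * t ^ 2)) • f + t • g
  let φ : Option F → V := fun o => o.elim f p
  have hpf (t : F) : polar Q (p t) f = 1 := by
    simp [p, polar_add_left, polar_smul_left, hef, hff, hgf]
  have hpp (s t : F) : polar Q (p s) (p t) = -Q g * (s - t) ^ 2 := by
    simp only [p, polar_add_left, polar_add_right, polar_smul_left, polar_smul_right, smul_eq_mul,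
      hee, hef, heg, hfe, hff, hfg, hge, hgf, hgg]
    ring
  have hφQ (o) : Q (φ o) = 0 := by
    cases o with
    | none => exact hQf
    | some t => simp only [φ, p, Option.elim, hQ]; ring
  have hφ0 (o) : φ o ≠ 0 := by
    cases o with
    | none => rintro (h : f = 0); simp [h] at hef
    | some t => rintro (h : p t = 0); simpa [h] using hpf t
  have hinj : Function.Injective fun o => LinearMap.ker (Q.polarBilin (φ o)) := by
    intro o o' h
    have key : polar Q (φ o) (φ o') = 0 := by
      have hmem : φ o' ∈ LinearMap.ker (Q.polarBilin (φ o')) := by simp [polar_self, hφQ]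
      exact (SetLike.ext_iff.mp h (φ o')).mpr hmem
    match o, o' with
    | none, none => rfl
    | none, some t => exact absurd ((polar_comm Q _ _).trans key) (by simp [φ, hpf])
    | some s, none => exact absurd key (by simp [φ, hpf])
    | some s, some t => simpa [φ, hpp, hQg, sub_eq_zero] using key
  have hset : {U : Submodule F V | Module.finrank F U = 2 ∧
      ∃ u ∈ U, u ≠ 0 ∧ ∀ w ∈ U, polar Q u w = 0} =
      Set.range fun o => LinearMap.ker (Q.polarBilin (φ o)) := by
    ext U
    rw [Set.mem_ofPred_eq, Q.degenerate_plane_iff h2 hV hB]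
    constructor
    · rintro ⟨u, hu, hQu, rfl⟩
      obtain ⟨o, a, ha, rfl⟩ : ∃ o, ∃ a : F, a ≠ 0 ∧ u = a • φ o := by
        obtain ⟨x, y, z, rfl⟩ := hspan u
        rw [hQ] at hQu
        by_cases hx : x = 0
        · subst hx
          obtain rfl : z = 0 := by simpa [hQg] using hQu
          exact ⟨none, y, fun h => hu (by simp [h]), by simp [φ]⟩
        · refine ⟨some (z / x), x, hx, ?_⟩
          have hy : y = x * -(Q g * (z / x) ^ 2) := by
            field_simp
            linear_combination hQu
          have hz : z = x * (z / x) := by field_simp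
          simp only [φ, p, Option.elim, smul_add, smul_smul, mul_one]
          rw [← hy, ← hz]
      exact ⟨o, by simp only [map_smul, LinearMap.ker_smul _ a ha]⟩
    · rintro ⟨o, rfl⟩
      exact ⟨φ o, hφ0 o, hφQ o, rfl⟩
  rw [hset, ← Set.image_univ, Set.ncard_image_of_injective _ hinj, Set.ncard_univ,
    Nat.card_eq_fintype_card, Fintype.card_option]
end

section
/- Let F be a finite field of odd cardinality q, let V be a 3-dimensional vector space over F, and let Q be a quadratic form on V whose polar form B(u, w) = Q(u + w) − Q(u) − Q(w) is nondegenerate on V. Then the number of 2-dimensional subspaces U ≤ V which are nondegenerate (the restriction of B to U is nondegenerate) and contain a nonzero isotropic vector (some nonzero u ∈ U with Q(u) = 0) — the 2-spaces of plus type — is exactly q(q + 1)/2. -/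
open QuadraticMap

section PlusTypePlanes

variable {F V : Type*} [Field F] [AddCommGroup V] [Module F V] (Q : QuadraticForm F V)

/-- A two-dimensional subspace on which the polar form is nondegenerate and which contains a
nonzero isotropic vector. -/
def IsPlusPlane (U : Submodule F V) : Prop :=
  Module.finrank F U = 2 ∧ (∀ u ∈ U, (∀ w ∈ U, polar Q u w = 0) → u = 0) ∧
    ∃ u ∈ U, u ≠ 0 ∧ Q u = 0

variable {Q}

lemma polar_self_eq_zero_of_isotropic {x : V} (hx : Q x = 0) : polar Q x x = 0 := by
  simp [polar_self, hx]

lemma linearIndependent_pair_of_polar_ne_zero {x y : V} (hx : Q x = 0) (hy : Q y = 0)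
    (hxy : polar Q x y ≠ 0) : LinearIndependent F ![x, y] := by
  rw [LinearIndependent.pair_iff]
  intro a b h
  have h1 := congrArg (polar Q x) h
  have h2 := congrArg (polar Q y) h
  simp [polar_add_right, polar_smul_right, hx, hy,
    polar_comm Q y x, hxy] at h1 h2
  exact ⟨h2, h1⟩

lemma finrank_span_pair_of_polar_ne_zero {x y : V} (hx : Q x = 0) (hy : Q y = 0)
    (hxy : polar Q x y ≠ 0) : Module.finrank F (Submodule.span F {x, y}) = 2 := by
  have := finrank_span_eq_card (linearIndependent_pair_of_polar_ne_zero hx hy hxy)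
  rwa [Matrix.range_cons_cons_empty, Fintype.card_fin] at this

lemma isPlusPlane_span_pair {x y : V} (hx : Q x = 0) (hy : Q y = 0)
    (hxy : polar Q x y ≠ 0) : IsPlusPlane Q (Submodule.span F {x, y}) := by
  refine ⟨finrank_span_pair_of_polar_ne_zero hx hy hxy, ?_, x,
    Submodule.subset_span (by simp), ?_, hx⟩
  · intro u hu h
    obtain ⟨a, b, rfl⟩ := Submodule.mem_span_pair.1 hu
    have h1 := h x (Submodule.subset_span (by simp))
    have h2 := h y (Submodule.subset_span (by simp))
    simp [polar_add_left, polar_smul_left, hx, hy,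
      polar_comm Q y x, hxy] at h1 h2
    simp [h1, h2]
  · rintro rfl
    simp at hxy

/-- The isotropic vectors of a hyperbolic plane lie on the two lines spanned by its hyperbolic
pair. -/
lemma polar_eq_zero_or_of_isotropic_mem_span_pair {x y z : V} (hx : Q x = 0) (hy : Q y = 0)
    (hxy : polar Q x y ≠ 0) (hz : Q z = 0) (hmem : z ∈ Submodule.span F {x, y}) :
    polar Q x z = 0 ∨ polar Q y z = 0 := by
  obtain ⟨a, b, rfl⟩ := Submodule.mem_span_pair.1 hmem
  simp [QuadraticMap.map_add Q, QuadraticMap.map_smul, polar_smul_left, polar_smul_right, hx, hy,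
    hxy] at hz
  rcases hz with rfl | rfl <;>
    simp [polar_smul_right, hx, hy]

/-- Given an isotropic vector not orthogonal to `x`, the line through `x` in direction `u`
contains an isotropic vector. -/
lemma isotropic_sub_smul {u x : V} (hu : Q u = 0) (hux : polar Q u x ≠ 0) :
    Q (x - (Q x / polar Q u x) • u) = 0 := by
  rw [sub_eq_add_neg, ← neg_smul, QuadraticMap.map_add Q, QuadraticMap.map_smul,
    polar_smul_right, polar_comm Q x u]
  simp [hu, hux]

/-- If the isotropic lines are represented without repetition by pairwise non-orthogonal vectors
`v i`, then planes of plus type correspond to pairs of indices. -/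
lemma ncard_isPlusPlane [FiniteDimensional F V] {ι : Type*} [Fintype ι] (v : ι → V)
    (hQ : ∀ i, Q (v i) = 0) (hv : ∀ i j, i ≠ j → polar Q (v i) (v j) ≠ 0)
    (hex : ∀ x, x ≠ 0 → Q x = 0 → ∃ i, ∃ a : F, a ≠ 0 ∧ x = a • v i) :
    {U : Submodule F V | IsPlusPlane Q U}.ncard = (Fintype.card ι).choose 2 := by
  classical
  have hspan : ∀ U : Submodule F V, Module.finrank F U = 2 → ∀ i j, i ≠ j → v i ∈ U → v j ∈ U →
      Submodule.span F {v i, v j} = U := by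
    intro U hU i j hij hi hj
    apply Submodule.eq_of_le_of_finrank_eq
    · rw [Submodule.span_le]
      rintro x (rfl | rfl) <;> assumption
    · rw [hU, finrank_span_pair_of_polar_ne_zero (hQ i) (hQ j) (hv i j hij)]
  have hfilter : ∀ i j, i ≠ j →
      Finset.univ.filter (fun k => v k ∈ Submodule.span F {v i, v j}) = {i, j} := by
    intro i j hij
    ext k
    simp only [Finset.mem_filter, Finset.mem_univ, true_and, Finset.mem_insert,
      Finset.mem_singleton]
    constructor
    · intro hk
      by_contra! hne
      rcases polar_eq_zero_or_of_isotropic_mem_span_pair (hQ i) (hQ j) (hv i j hij) (hQ k) hk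
        with h | h
      · exact hv i k hne.1.symm h
      · exact hv j k hne.2.symm h
    · rintro (rfl | rfl) <;> exact Submodule.subset_span (by simp)
  have hpair : ∀ U : Submodule F V, IsPlusPlane Q U →
      ∃ i j, i ≠ j ∧ Submodule.span F {v i, v j} = U := by
    rintro U ⟨hU, hnd, u, huU, hu, hQu⟩
    obtain ⟨x, hxU, hux⟩ : ∃ x ∈ U, polar Q u x ≠ 0 := by
      by_contra! h
      exact hu (hnd u huU h)
    set y := x - (Q x / polar Q u x) • u with hy
    have hyU : y ∈ U := U.sub_mem hxU (U.smul_mem _ huU)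
    have hQy : Q y = 0 := isotropic_sub_smul hQu hux
    have huy : polar Q u y ≠ 0 := by
      rw [hy, polar_sub_right, polar_smul_right]
      simpa [polar_self_eq_zero_of_isotropic hQu] using hux
    have hy0 : y ≠ 0 := by
      intro h
      simp [h] at huy
    obtain ⟨i, a, ha, hui⟩ := hex u hu hQu
    obtain ⟨j, b, hb, hyj⟩ := hex y hy0 hQy
    refine ⟨i, j, ?_, hspan U hU i j ?_ ?_ ?_⟩
    · rintro rfl
      rw [hui, hyj] at huy
      simp [polar_smul_left, polar_smul_right, polar_self_eq_zero_of_isotropic (hQ i)] at huy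
    · rintro rfl
      rw [hui, hyj] at huy
      simp [polar_smul_left, polar_smul_right, polar_self_eq_zero_of_isotropic (hQ i)] at huy
    · rwa [hui, U.smul_mem_iff ha] at huU
    · rwa [hyj, U.smul_mem_iff hb] at hyU
  have hbij : Set.BijOn (fun U : Submodule F V => Finset.univ.filter fun k => v k ∈ U)
      {U | IsPlusPlane Q U} (Finset.powersetCard 2 (Finset.univ : Finset ι)) := by
    refine ⟨?_, ?_, ?_⟩
    · intro U hU
      obtain ⟨i, j, hij, rfl⟩ := hpair U hU
      simp [hfilter i j hij, Finset.card_pair hij]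
    · intro U hU W hW h
      obtain ⟨i, j, hij, rfl⟩ := hpair U hU
      dsimp only at h
      rw [hfilter i j hij] at h
      have hi : i ∈ Finset.univ.filter (fun k => v k ∈ W) := h ▸ by simp
      have hj : j ∈ Finset.univ.filter (fun k => v k ∈ W) := h ▸ by simp
      exact hspan W hW.1 i j hij (by simpa using hi) (by simpa using hj)
    · intro s hs
      obtain ⟨i, j, hij, rfl⟩ := Finset.card_eq_two.1 (Finset.mem_powersetCard.1 hs).2
      exact ⟨_, isPlusPlane_span_pair (hQ i) (hQ j) (hv i j hij), hfilter i j hij⟩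
  rw [← hbij.injOn.ncard_image, hbij.image_eq, Set.ncard_coe_finset,
    Finset.card_powersetCard, Finset.card_univ]

lemma exists_ne_zero_orthogonal_pair [FiniteDimensional F V] (hV : 2 < Module.finrank F V)
    (x y : V) : ∃ w, w ≠ 0 ∧ polar Q x w = 0 ∧ polar Q y w = 0 := by
  have h : LinearMap.ker ((polarBilin Q x).prod (polarBilin Q y)) ≠ ⊥ :=
    LinearMap.ker_ne_bot_of_finrank_lt (by simpa using hV)
  obtain ⟨w, hw, hw0⟩ := Submodule.exists_mem_ne_zero_of_ne_bot h
  refine ⟨w, hw0, ?_⟩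
  simpa using hw

/-- A quadratic form of dimension at least three over a finite field of odd order is isotropic. -/
lemma exists_isotropic [Fintype F] [FiniteDimensional F V] (hodd : Odd (Fintype.card F))
    (hV : 2 < Module.finrank F V) : ∃ e, e ≠ 0 ∧ Q e = 0 := by
  have h2 : (2 : F) ≠ 0 := by
    apply Ring.two_ne_zero
    intro h
    have := FiniteField.even_card_of_char_two h
    have := Nat.odd_iff.1 hodd
    omega
  by_contra! han
  obtain ⟨x, hx, -⟩ := exists_ne_zero_orthogonal_pair (Q := Q) hV 0 0
  obtain ⟨y, hy, hxy, -⟩ := exists_ne_zero_orthogonal_pair (Q := Q) hV x x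
  obtain ⟨z, hz, hxz, hyz⟩ := exists_ne_zero_orthogonal_pair (Q := Q) hV x y
  obtain ⟨a, b, hab⟩ := FiniteField.exists_root_sum_quadratic
    (f := Polynomial.C (Q y) * Polynomial.X ^ 2 + Polynomial.C 0 * Polynomial.X
      + Polynomial.C (Q x))
    (g := Polynomial.C (Q z) * Polynomial.X ^ 2 + Polynomial.C 0 * Polynomial.X
      + Polynomial.C 0)
    (Polynomial.degree_quadratic (han y hy)) (Polynomial.degree_quadratic (han z hz))
    (Nat.odd_iff.1 hodd)
  refine han (x + a • y + b • z) ?_ ?_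
  · intro h
    have := congrArg (polar Q x) h
    simp [polar_add_right, polar_smul_right, hxy, hxz, h2, han x hx] at this
  · simp only [Polynomial.eval_add, Polynomial.eval_mul, Polynomial.eval_C, Polynomial.eval_pow,
      Polynomial.eval_X] at hab
    simp only [QuadraticMap.map_add Q, QuadraticMap.map_smul, polar_smul_left, polar_smul_right,
      polar_add_left, hxy, hxz, hyz, smul_eq_mul]
    linear_combination hab

/-- A nondegenerate isotropic ternary form is `xy + cz²` in suitable coordinates. -/
lemma exists_hyperbolic_basis [FiniteDimensional F V] (hV : Module.finrank F V = 3)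
    (hB : ∀ u : V, (∀ w : V, polar Q u w = 0) → u = 0) {e : V} (he : e ≠ 0) (hQe : Q e = 0) :
    ∃ f w : V, (∀ x : V, ∃ a b c : F, a • e + b • f + c • w = x) ∧ Q w ≠ 0 ∧
      ∀ a b c : F, Q (a • e + b • f + c • w) = a * b + c ^ 2 * Q w := by
  obtain ⟨g, hg⟩ : ∃ g, polar Q e g ≠ 0 := by
    by_contra! h
    exact he (hB e h)
  obtain ⟨f, hQf, hef⟩ : ∃ f, Q f = 0 ∧ polar Q e f = 1 := by
    refine ⟨(polar Q e g)⁻¹ • (g - (Q g / polar Q e g) • e), ?_, ?_⟩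
    · rw [QuadraticMap.map_smul, isotropic_sub_smul hQe hg, smul_zero]
    · rw [polar_smul_right, polar_sub_right, polar_smul_right,
        polar_self_eq_zero_of_isotropic hQe]
      simp [hg]
  obtain ⟨w, hw, hew, hfw⟩ := exists_ne_zero_orthogonal_pair (Q := Q) (by omega) e f
  have hli : LinearIndependent F ![e, f, w] := by
    rw [Fintype.linearIndependent_iff]
    intro c hc
    simp only [Fin.sum_univ_three, Matrix.cons_val] at hc
    have h1 := congrArg (polar Q e) hc
    have h2 := congrArg (polar Q f) hc
    simp [polar_add_right, polar_smul_right, hQe, hQf, hef, hew,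
      hfw, polar_comm Q f e] at h1 h2
    simp only [h1, h2, zero_smul, zero_add, smul_eq_zero, hw, or_false] at hc
    intro i
    fin_cases i <;> assumption
  have hspan : ∀ x : V, ∃ a b c : F, a • e + b • f + c • w = x := by
    intro x
    have h := hli.span_eq_top_of_card_eq_finrank (by simp [hV])
    have hx : x ∈ Submodule.span F (Set.range ![e, f, w]) := h ▸ Submodule.mem_top
    obtain ⟨c, hc⟩ := (Submodule.mem_span_range_iff_exists_fun F).1 hx
    exact ⟨c 0, c 1, c 2, by simpa [Fin.sum_univ_three] using hc⟩
  refine ⟨f, w, hspan, ?_, ?_⟩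
  · intro hQw
    refine hw (hB w fun x => ?_)
    obtain ⟨a, b, c, rfl⟩ := hspan x
    rw [polar_comm]
    simp [polar_add_left, polar_smul_left, hew, hfw,
      polar_self_eq_zero_of_isotropic hQw]
  · intro a b c
    simp only [QuadraticMap.map_add Q, QuadraticMap.map_smul, polar_smul_left, polar_smul_right,
      polar_add_left, hef, hew, hfw, hQe, hQf, smul_eq_mul]
    ring

end PlusTypePlanes

theorem card_plus_type_two_spaces {F V : Type*} [Field F] [Fintype F]
    [AddCommGroup V] [Module F V] [FiniteDimensional F V]
    (q : ℕ) (hq : q = Fintype.card F) (hodd : Odd q)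
    (hV : Module.finrank F V = 3)
    (Q : QuadraticForm F V)
    (hB : ∀ u : V, (∀ w : V, QuadraticMap.polar Q u w = 0) → u = 0) :
    2 * {U : Submodule F V | Module.finrank F U = 2 ∧
       (∀ u ∈ U, (∀ w ∈ U, QuadraticMap.polar Q u w = 0) → u = 0) ∧
       (∃ u ∈ U, u ≠ 0 ∧ Q u = 0)}.ncard = q * (q + 1) := by
  obtain ⟨e, he, hQe⟩ := exists_isotropic (Q := Q) (hq ▸ hodd) (by omega)
  obtain ⟨f, w, hspan, hQw, hform⟩ := exists_hyperbolic_basis hV hB he hQe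
  let v : Option F → V := fun i =>
    i.elim ((1 : F) • e + (0 : F) • f + (0 : F) • w)
      fun t => (-(Q w * t ^ 2)) • e + (1 : F) • f + t • w
  have hpolar : ∀ a b c a' b' c' : F,
      polar Q (a • e + b • f + c • w) (a' • e + b' • f + c' • w) =
        a * b' + a' * b + 2 * c * c' * Q w := by
    intro a b c a' b' c'
    have : a • e + b • f + c • w + (a' • e + b' • f + c' • w) =
        (a + a') • e + (b + b') • f + (c + c') • w := by module
    rw [polar, this, hform, hform, hform]
    ring
  have hcount := ncard_isPlusPlane (Q := Q) v ?_ ?_ ?_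
  · have hset : {U : Submodule F V | IsPlusPlane Q U}.ncard = (q + 1).choose 2 := by
      simpa [← hq] using hcount
    change 2 * {U : Submodule F V | IsPlusPlane Q U}.ncard = _
    rw [hset, Nat.choose_two_right, Nat.add_sub_cancel,
      Nat.mul_div_cancel' (by simpa [mul_comm] using (Nat.even_mul_succ_self q).two_dvd),
      mul_comm]
  · rintro (_ | t) <;> simp only [v, Option.elim_none, Option.elim_some, hform] <;> ring
  · rintro (_ | s) (_ | t) hst <;>
      simp only [v, Option.elim_none, Option.elim_some, hpolar]
    · exact absurd rfl hst
    · simp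
    · simp
    · have hne : s - t ≠ 0 := sub_ne_zero.2 fun h => hst (by rw [h])
      have : -(Q w * s ^ 2) * 1 + -(Q w * t ^ 2) * 1 + 2 * s * t * Q w =
          -(Q w * (s - t) ^ 2) := by ring
      rw [this]
      exact neg_ne_zero.2 (mul_ne_zero hQw (pow_ne_zero 2 hne))
  · intro x hx hQx
    obtain ⟨a, b, c, rfl⟩ := hspan x
    rw [hform] at hQx
    by_cases hb : b = 0
    · subst hb
      have hc : c = 0 := by simpa [hQw] using hQx
      subst hc
      refine ⟨none, a, ?_, ?_⟩
      · rintro rfl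
        simp at hx
      · simp [v]
    · refine ⟨some (c / b), b, hb, ?_⟩
      have ha : a = b * -(Q w * (c / b) ^ 2) := by
        field_simp
        linear_combination hQx
      have hc : b * (c / b) = c := by field_simp
      simp only [v, Option.elim_some, smul_add, smul_smul, ← ha, hc, mul_one]
end
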